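/- For every λ > 0 and every Mather measure μ one has ∫ u_λ(x) dμ(x,q) ≤ 0. -/

import Mathlib

open MeasureTheory Set
open scoped RealInnerProductSpace

noncomputable section

abbrev Euc (N : ℕ) := EuclideanSpace ℝ (Fin N)

/-- `u` is an (a.e.) subsolution of `H = a` in `ℝ^N`. -/
def IsSubsol {N : ℕ} (H : Euc N × Euc N → ℝ) (a : ℝ) (u : Euc N → ℝ) : Prop :=
  LocallyLipschitz u ∧
    ∀ᵐ x : Euc N ∂volume, DifferentiableAt ℝ u x → H (x, gradient u x) ≤ a

/-- `u` is an (a.e.) subsolution of the discounted equation `λ u + H(x,Du) = 0`. -/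
def IsDiscSubsol {N : ℕ} (H : Euc N × Euc N → ℝ) (lam : ℝ) (u : Euc N → ℝ) : Prop :=
  LocallyLipschitz u ∧
    ∀ᵐ x : Euc N ∂volume, DifferentiableAt ℝ u x →
      lam * u x + H (x, gradient u x) ≤ 0

/-- The Lagrangian associated with `H` via the Fenchel transform. -/
def Lag {N : ℕ} (H : Euc N × Euc N → ℝ) : Euc N × Euc N → ℝ :=
  fun z => sSup (Set.range fun p : Euc N => ⟪p, z.2⟫ - H (z.1, p))

/-- `u` is a subsolution for the generalized Lagrangian `Φ`. -/
def SubsolFor {N : ℕ} (Φ : Euc N × Euc N → ℝ) (u : Euc N → ℝ) : Prop :=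
  LocallyLipschitz u ∧
    ∀ᵐ x : Euc N ∂volume, DifferentiableAt ℝ u x →
      ∀ q : Euc N, fderiv ℝ u x q ≤ Φ (x, q)

/-- `u` is a `λ`-discounted subsolution for the generalized Lagrangian `Φ`. -/
def DiscSubsolFor {N : ℕ} (lam : ℝ) (Φ : Euc N × Euc N → ℝ) (u : Euc N → ℝ) : Prop :=
  LocallyLipschitz u ∧
    ∀ᵐ x : Euc N ∂volume, DifferentiableAt ℝ u x →
      ∀ q : Euc N, lam * u x + fderiv ℝ u x q ≤ Φ (x, q)

/-- A Mather measure for the ergodic problem. -/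
def MatherMeasure {N : ℕ} (H : Euc N × Euc N → ℝ) (μ : Measure (Euc N × Euc N)) : Prop :=
  IsProbabilityMeasure μ ∧ Integrable (Lag H) μ ∧ (∫ z, Lag H z ∂μ) = 0 ∧
    ∀ Φ : Euc N × Euc N → ℝ, Continuous Φ → BddBelow (Set.range Φ) →
      (∃ u, SubsolFor Φ u) → (Integrable Φ μ → 0 ≤ ∫ z, Φ z ∂μ)

/-- A `(λ,z)`-Mather measure (relative to the maximal discounted solution `um`). -/
def DiscMatherMeasure {N : ℕ} (H : Euc N × Euc N → ℝ) (lam : ℝ) (z : Euc N)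
    (um : Euc N → ℝ) (μ : Measure (Euc N × Euc N)) : Prop :=
  IsProbabilityMeasure μ ∧ Integrable (Lag H) μ ∧ (∫ w, Lag H w ∂μ) = lam * um z ∧
    ∀ Φ : Euc N × Euc N → ℝ, Continuous Φ → BddBelow (Set.range Φ) →
      ∀ u : Euc N → ℝ, DiscSubsolFor lam Φ u →
        (Integrable Φ μ → lam * u z ≤ ∫ w, Φ w ∂μ)

/-- Rademacher's theorem for locally Lipschitz functions. -/
theorem LocallyLipschitz.ae_differentiableAt_euc {N : ℕ} {u : Euc N → ℝ}
    (hu : LocallyLipschitz u) : ∀ᵐ x : Euc N ∂volume, DifferentiableAt ℝ u x := by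
  rw [ae_iff]
  refine measure_null_of_locally_null _ fun x _ => ?_
  obtain ⟨K, t, ht, hK⟩ := hu x
  obtain ⟨s, hst, hs, hxs⟩ := mem_nhds_iff.1 ht
  refine ⟨{y | ¬ DifferentiableAt ℝ u y} ∩ s,
    Filter.inter_mem self_mem_nhdsWithin (mem_nhdsWithin_of_mem_nhds (hs.mem_nhds hxs)), ?_⟩
  have h := (hK.mono hst).ae_differentiableWithinAt_of_mem (μ := volume)
  rw [ae_iff] at h
  refine measure_mono_null (fun y hy => ?_) h
  simp only [mem_ofPred_eq, Classical.not_imp]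
  exact ⟨hy.2, fun h' => hy.1 (h'.differentiableAt (hs.mem_nhds hy.2))⟩

/-- Functions that touch at a point, one below the other, have the same gradient there. -/
theorem gradient_eq_of_le_of_eq {N : ℕ} {v g : Euc N → ℝ} {x : Euc N} (hle : v ≤ g)
    (heq : v x = g x) (hv : DifferentiableAt ℝ v x) (hg : DifferentiableAt ℝ g x) :
    gradient g x = gradient v x := by
  have hmin : IsLocalMin (g - v) x := Filter.Eventually.of_forall fun y => by
    have := hle y
    simp only [Pi.sub_apply]
    linarith
  have h := hmin.fderiv_eq_zero
  rw [fderiv_sub hg hv, sub_eq_zero] at h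
  simp only [gradient, h]

theorem IsDiscSubsol.sup {N : ℕ} {H : Euc N × Euc N → ℝ} {lam : ℝ} {v w : Euc N → ℝ}
    (hv : IsDiscSubsol H lam v) (hw : IsDiscSubsol H lam w) : IsDiscSubsol H lam (v ⊔ w) := by
  refine ⟨hv.1.max hw.1, ?_⟩
  filter_upwards [hv.2, hw.2, hv.1.ae_differentiableAt_euc, hw.1.ae_differentiableAt_euc]
    with x hvx hwx hdv hdw hd
  rcases le_total (w x) (v x) with h | h
  · have heq : v x = (v ⊔ w) x := by simp [h]
    rw [gradient_eq_of_le_of_eq le_sup_left heq hdv hd, ← heq]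
    exact hvx hdv
  · have heq : w x = (v ⊔ w) x := by simp [h]
    rw [gradient_eq_of_le_of_eq le_sup_right heq hdw hd, ← heq]
    exact hwx hdw

theorem IsDiscSubsol.partialSups {N : ℕ} {H : Euc N × Euc N → ℝ} {lam : ℝ}
    {f : ℕ → Euc N → ℝ} (hf : ∀ n, IsDiscSubsol H lam (f n)) (n : ℕ) :
    IsDiscSubsol H lam (partialSups f n) := by
  induction n with
  | zero => simpa using hf 0
  | succ n ih => rw [partialSups_add_one]; exact ih.sup (hf _)

theorem isDiscSubsol_const {N : ℕ} {H : Euc N × Euc N → ℝ} {lam c : ℝ}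
    (h : ∀ x, lam * c + H (x, 0) ≤ 0) : IsDiscSubsol H lam (Function.const _ c) := by
  refine ⟨LocallyLipschitz.const c, Filter.Eventually.of_forall fun x _ => ?_⟩
  rw [gradient_const]
  exact h x

/-- A coercive continuous Hamiltonian is bounded below over bounded sets of positions. -/
theorem exists_forall_le_of_coercive {N : ℕ} {H : Euc N × Euc N → ℝ} (hc : Continuous H)
    (hcoer : ∀ R : ℝ, 0 < R → ∀ C : ℝ, ∃ r : ℝ, ∀ x p : Euc N,
      ‖x‖ ≤ R → r ≤ ‖p‖ → C ≤ H (x, p)) {R : ℝ} (hR : 0 < R) :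
    ∃ B : ℝ, ∀ x p : Euc N, ‖x‖ ≤ R → B ≤ H (x, p) := by
  obtain ⟨r, hr⟩ := hcoer R hR 0
  obtain ⟨b, hb⟩ := ((isCompact_closedBall (0 : Euc N) R).prod
    (isCompact_closedBall (0 : Euc N) r)).bddBelow_image hc.continuousOn
  refine ⟨min b 0, fun x p hx => ?_⟩
  rcases le_total r ‖p‖ with h | h
  · exact (min_le_right _ _).trans (hr x p hx h)
  · exact (min_le_left _ _).trans (hb ⟨(x, p), ⟨by simpa using hx, by simpa using h⟩, rfl⟩)

/-- Discounted subsolutions are locally uniformly bounded above. -/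
theorem bddAbove_isDiscSubsol {N : ℕ} {H : Euc N × Euc N → ℝ} (hc : Continuous H)
    (hcoer : ∀ R : ℝ, 0 < R → ∀ C : ℝ, ∃ r : ℝ, ∀ x p : Euc N,
      ‖x‖ ≤ R → r ≤ ‖p‖ → C ≤ H (x, p)) {lam : ℝ} (hlam : 0 < lam) (x : Euc N) :
    BddAbove {r : ℝ | ∃ v : Euc N → ℝ, IsDiscSubsol H lam v ∧ v x = r} := by
  obtain ⟨B, hB⟩ := exists_forall_le_of_coercive hc hcoer (R := ‖x‖ + 1) (by positivity)
  refine ⟨-B / lam, ?_⟩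
  rintro _ ⟨v, hv, rfl⟩
  by_contra! hlt
  have hopen : IsOpen (v ⁻¹' Ioi (-B / lam) ∩ Metric.ball 0 (‖x‖ + 1)) :=
    (isOpen_Ioi.preimage hv.1.continuous).inter Metric.isOpen_ball
  have hpos := hopen.measure_pos volume ⟨x, hlt, by simp⟩
  have hae : ∀ᵐ y : Euc N ∂volume, y ∉ v ⁻¹' Ioi (-B / lam) ∩ Metric.ball 0 (‖x‖ + 1) := by
    filter_upwards [hv.2, hv.1.ae_differentiableAt_euc] with y hy hd hmem
    have h1 := hB y (gradient v y) (by simpa using (mem_ball_zero_iff.1 hmem.2).le)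
    have h2 : -B / lam < v y := hmem.1
    rw [div_lt_iff₀ hlam] at h2
    linarith [hy hd]
  exact hpos.ne' (measure_eq_zero_iff_ae_notMem.2 hae)

/-- Locally in `z`, the supremum defining the Lagrangian may be restricted to a ball. -/
theorem exists_eventually_forall_inner_sub_le {N : ℕ} {H : Euc N × Euc N → ℝ} (hc : Continuous H)
    (hconv : ∀ x : Euc N, ConvexOn ℝ Set.univ fun p => H (x, p))
    (hsl : ∀ x : Euc N, ∀ C : ℝ, ∃ r : ℝ, ∀ p : Euc N, r ≤ ‖p‖ → C * ‖p‖ ≤ H (x, p))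
    (z : Euc N × Euc N) :
    ∃ r : ℝ, 0 < r ∧ ∀ᶠ y in nhds z, ∀ p : Euc N, r ≤ ‖p‖ →
      ⟪p, y.2⟫ - H (y.1, p) ≤ -H (y.1, 0) := by
  set C : ℝ := ‖z.2‖ + 1 + |H (z.1, 0)| with hC
  obtain ⟨s, hs⟩ := hsl z.1 C
  set r : ℝ := max s 1
  have hr1 : 1 ≤ r := le_max_right _ _
  have hr0 : 0 < r := by linarith
  refine ⟨r, hr0, ?_⟩
  have key : ∀ᶠ y in nhds z, ∀ p ∈ Metric.sphere (0 : Euc N) r,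
      ⟪p, y.2⟫ - H (y.1, p) < -H (y.1, 0) := by
    refine (isCompact_sphere (0 : Euc N) r).eventually_forall_of_forall_eventually fun p hp => ?_
    have hcont : Continuous fun w : (Euc N × Euc N) × Euc N =>
        ⟪w.2, w.1.2⟫ - H (w.1.1, w.2) + H (w.1.1, 0) := by fun_prop
    have hp : ‖p‖ = r := by simpa using hp
    have hval : ⟪p, z.2⟫ - H (z.1, p) + H (z.1, 0) < 0 := by
      have h1 := hs p (by rw [hp]; exact le_max_left _ _)
      have h2 := real_inner_le_norm p z.2
      have h3 := le_abs_self (H (z.1, 0))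
      have h4 := abs_nonneg (H (z.1, 0))
      rw [hp] at h1 h2
      nlinarith
    filter_upwards [(hcont.tendsto (z, p)).eventually_lt_const hval] with w hw
    linarith
  filter_upwards [key] with y hy p hp
  have hp0 : 0 < ‖p‖ := by linarith
  set t : ℝ := r / ‖p‖ with ht
  have ht0 : 0 < t := by positivity
  have ht1 : t ≤ 1 := (div_le_one hp0).2 hp
  have hsph := hy (t • p) (by
    rw [mem_sphere_zero_iff_norm, norm_smul, Real.norm_of_nonneg ht0.le, ht,
      div_mul_cancel₀ _ hp0.ne'])
  have hcv := (hconv y.1).2 (mem_univ p) (mem_univ 0) ht0.le (sub_nonneg.2 ht1) (by ring)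
  simp only [smul_zero, add_zero, smul_eq_mul] at hcv
  rw [real_inner_smul_left] at hsph
  have : t * (⟪p, y.2⟫ - H (y.1, p)) ≤ t * -H (y.1, 0) := by linarith
  exact le_of_mul_le_mul_left this ht0

theorem bddAbove_range_inner_sub {N : ℕ} {H : Euc N × Euc N → ℝ} (hc : Continuous H)
    (hconv : ∀ x : Euc N, ConvexOn ℝ Set.univ fun p => H (x, p))
    (hsl : ∀ x : Euc N, ∀ C : ℝ, ∃ r : ℝ, ∀ p : Euc N, r ≤ ‖p‖ → C * ‖p‖ ≤ H (x, p))
    (z : Euc N × Euc N) :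
    BddAbove (range fun p : Euc N => ⟪p, z.2⟫ - H (z.1, p)) := by
  obtain ⟨r, -, hr⟩ := exists_eventually_forall_inner_sub_le hc hconv hsl z
  obtain ⟨b, hb⟩ := (isCompact_closedBall (0 : Euc N) r).bddAbove_image
    (f := fun p : Euc N => ⟪p, z.2⟫ - H (z.1, p)) (by fun_prop)
  refine ⟨max b (-H (z.1, 0)), ?_⟩
  rintro _ ⟨p, rfl⟩
  rcases le_total r ‖p‖ with h | h
  · exact (hr.self_of_nhds p h).trans (le_max_right _ _)
  · exact (hb ⟨p, by simpa using h, rfl⟩).trans (le_max_left _ _)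

theorem inner_sub_le_Lag {N : ℕ} {H : Euc N × Euc N → ℝ} (hc : Continuous H)
    (hconv : ∀ x : Euc N, ConvexOn ℝ Set.univ fun p => H (x, p))
    (hsl : ∀ x : Euc N, ∀ C : ℝ, ∃ r : ℝ, ∀ p : Euc N, r ≤ ‖p‖ → C * ‖p‖ ≤ H (x, p))
    (x p q : Euc N) : ⟪p, q⟫ - H (x, p) ≤ Lag H (x, q) :=
  le_csSup (bddAbove_range_inner_sub hc hconv hsl (x, q)) ⟨p, rfl⟩

theorem continuous_Lag {N : ℕ} {H : Euc N × Euc N → ℝ} (hc : Continuous H)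
    (hconv : ∀ x : Euc N, ConvexOn ℝ Set.univ fun p => H (x, p))
    (hsl : ∀ x : Euc N, ∀ C : ℝ, ∃ r : ℝ, ∀ p : Euc N, r ≤ ‖p‖ → C * ‖p‖ ≤ H (x, p)) :
    Continuous (Lag H) := by
  refine continuous_iff_continuousAt.2 fun z => ?_
  obtain ⟨r, hr0, hr⟩ := exists_eventually_forall_inner_sub_le hc hconv hsl z
  have hcont : Continuous fun y : Euc N × Euc N =>
      sSup ((fun p : Euc N => ⟪p, y.2⟫ - H (y.1, p)) '' Metric.closedBall 0 r) :=
    (isCompact_closedBall (0 : Euc N) r).continuous_sSup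
      (f := fun (y : Euc N × Euc N) p => ⟪p, y.2⟫ - H (y.1, p))
      (by simp only [Function.HasUncurry.uncurry, id]; fun_prop)
  refine hcont.continuousAt.congr ?_
  filter_upwards [hr] with y hy
  refine csSup_eq_csSup_of_forall_exists_le ?_ ?_
  · rintro _ ⟨p, -, rfl⟩
    exact ⟨_, ⟨p, rfl⟩, le_rfl⟩
  · rintro _ ⟨p, rfl⟩
    rcases le_total r ‖p‖ with h | h
    · exact ⟨_, ⟨0, by simpa using hr0.le, rfl⟩, by simpa using hy p h⟩
    · exact ⟨_, ⟨p, by simpa using h, rfl⟩, le_rfl⟩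

/-- A discounted subsolution truncated from above has nonpositive integral against every
Mather measure. -/
theorem MatherMeasure.integral_min_le {N : ℕ} {H : Euc N × Euc N → ℝ} (hc : Continuous H)
    (hconv : ∀ x : Euc N, ConvexOn ℝ Set.univ fun p => H (x, p))
    (hsl : ∀ x : Euc N, ∀ C : ℝ, ∃ r : ℝ, ∀ p : Euc N, r ≤ ‖p‖ → C * ‖p‖ ≤ H (x, p))
    {μ : Measure (Euc N × Euc N)} (hμ : MatherMeasure H μ)
    {A : ℝ} (hA : ∀ x, H (x, 0) ≤ A) {lam : ℝ} (hlam : 0 < lam) {v : Euc N → ℝ}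
    (hv : IsDiscSubsol H lam v) (k : ℝ)
    (hint : Integrable (fun w : Euc N × Euc N => min (v w.1) k) μ) :
    ∫ w : Euc N × Euc N, min (v w.1) k ∂μ ≤ 0 := by
  obtain ⟨-, hLint, hL0, hΦ⟩ := hμ
  have hvc := hv.1.continuous
  have hLc := continuous_Lag hc hconv hsl
  have h := hΦ (fun w => Lag H w - lam * min (v w.1) k) (by fun_prop) ?_ ⟨v, hv.1, ?_⟩
    (hLint.sub (hint.const_mul lam))
  · rw [integral_sub hLint (hint.const_mul lam), hL0, integral_const_mul] at h
    nlinarith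
  · refine ⟨-A - lam * k, ?_⟩
    rintro _ ⟨w, rfl⟩
    have h1 := inner_sub_le_Lag hc hconv hsl w.1 0 w.2
    rw [inner_zero_left] at h1
    have h2 := mul_le_mul_of_nonneg_left (min_le_right (v w.1) k) hlam.le
    have h3 := hA w.1
    simp only [Prod.mk.eta] at h1
    linarith
  · filter_upwards [hv.2] with x hx hd q
    have h1 := inner_sub_le_Lag hc hconv hsl x (gradient v x) q
    have h2 : ⟪gradient v x, q⟫ = fderiv ℝ v x q := InnerProductSpace.toDual_symm_apply
    have h3 := mul_le_mul_of_nonneg_left (min_le_left (v x) k) hlam.le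
    have h4 := hx hd
    linarith

/-- If a constant is a discounted subsolution, the supremum `U` of all discounted subsolutions is
the pointwise limit of a sequence of discounted subsolutions bounded below by that constant. -/
theorem exists_seq_isDiscSubsol_tendsto {N : ℕ} {H : Euc N × Euc N → ℝ} {lam c : ℝ}
    {U : Euc N → ℝ} (hU : IsLUB {v | IsDiscSubsol H lam v} U)
    (hconst : IsDiscSubsol H lam (Function.const _ c)) :
    ∃ w : ℕ → Euc N → ℝ, (∀ n, IsDiscSubsol H lam (w n)) ∧ (∀ n x, c ≤ w n x) ∧
      ∀ x, Filter.Tendsto (fun n => w n x) Filter.atTop (nhds (U x)) := by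
  have hcU : Function.const _ c ≤ U := hU.1 hconst
  obtain ⟨F, hFsub, hFc, hF⟩ := exists_countable_lowerSemicontinuous_isLUB
    (fun v (hv : IsDiscSubsol H lam v) => hv.1.continuous.lowerSemicontinuous) hU
  obtain ⟨f, hf⟩ := (hFc.insert (Function.const _ c)).exists_eq_range (insert_nonempty _ _)
  have hfsub : ∀ n, IsDiscSubsol H lam (f n) := fun n => by
    have : f n ∈ insert (Function.const _ c) F := hf ▸ mem_range_self n
    rcases this with h | h
    · rw [h]; exact hconst
    · exact hFsub h
  have hfU : IsLUB (range fun n => partialSups f n) U := by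
    have h := hF.insert (Function.const _ c)
    rw [hf, sup_eq_right.2 hcU] at h
    refine ⟨?_, fun g hg => h.2 ?_⟩
    · rintro _ ⟨n, rfl⟩
      exact partialSups_le f n U fun i _ => h.1 ⟨i, rfl⟩
    · rintro _ ⟨n, rfl⟩
      exact (le_partialSups f n).trans (hg ⟨n, rfl⟩)
  refine ⟨fun n => partialSups f n ⊔ Function.const _ c,
    fun n => (IsDiscSubsol.partialSups hfsub n).sup hconst, fun n x => le_max_right _ _,
    fun x => ?_⟩
  have hx := tendsto_pi_nhds.1 (tendsto_atTop_isLUB (partialSups f).monotone hfU) x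
  have := hx.max (tendsto_const_nhds (x := c))
  rwa [max_eq_left (show c ≤ U x from hcU x)] at this

/-- Fatou's lemma for real functions bounded below, on a probability space. -/
theorem integrable_and_integral_nonpos_of_tendsto {α : Type*} [MeasurableSpace α]
    {μ : Measure α} [IsProbabilityMeasure μ] {g : ℕ → α → ℝ} {G : α → ℝ} {D : ℝ}
    (hm : ∀ n, Measurable (g n)) (hint : ∀ n, Integrable (g n) μ) (hD : ∀ n x, -D ≤ g n x)
    (hle : ∀ n, ∫ x, g n x ∂μ ≤ 0)
    (hlim : ∀ x, Filter.Tendsto (fun n => g n x) Filter.atTop (nhds (G x))) :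
    Integrable G μ ∧ ∫ x, G x ∂μ ≤ 0 := by
  have hGm : Measurable G := measurable_of_tendsto_metrizable hm (tendsto_pi_nhds.2 hlim)
  have hGD : ∀ x, -D ≤ G x := fun x => ge_of_tendsto' (hlim x) fun n => hD n x
  have hfatou : ∫⁻ x, ENNReal.ofReal (G x + D) ∂μ ≤ ENNReal.ofReal D := by
    calc ∫⁻ x, ENNReal.ofReal (G x + D) ∂μ
        = ∫⁻ x, Filter.liminf (fun n => ENNReal.ofReal (g n x + D)) Filter.atTop ∂μ := by
          refine lintegral_congr fun x => ?_
          exact (ENNReal.tendsto_ofReal ((hlim x).add_const D)).liminf_eq.symm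
      _ ≤ Filter.liminf (fun n => ∫⁻ x, ENNReal.ofReal (g n x + D) ∂μ) Filter.atTop :=
          lintegral_liminf_le fun n => ((hm n).add_const D).ennreal_ofReal
      _ ≤ ENNReal.ofReal D := by
          refine Filter.liminf_le_of_frequently_le' (Filter.Frequently.of_forall fun n => ?_)
          rw [← ofReal_integral_eq_lintegral_ofReal (integrable_add_const_iff.2 (hint n))
            (Filter.Eventually.of_forall fun x => by
              have := hD n x; simp only [Pi.zero_apply]; linarith)]
          refine ENNReal.ofReal_le_ofReal ?_
          rw [integral_add (hint n) (integrable_const D)]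
          simpa using hle n
  have hnonneg : ∀ x, 0 ≤ G x + D := fun x => by linarith [hGD x]
  have hGDint : Integrable (fun x => G x + D) μ := by
    refine ⟨(hGm.add_const D).aestronglyMeasurable, ?_⟩
    rw [hasFiniteIntegral_iff_ofReal (Filter.Eventually.of_forall hnonneg)]
    exact hfatou.trans_lt ENNReal.ofReal_lt_top
  have hGint : Integrable G μ := integrable_add_const_iff.1 hGDint
  refine ⟨hGint, ?_⟩
  have hDnn : 0 ≤ D := by
    have h1 : -D ≤ ∫ x, g 0 x ∂μ := by
      simpa using integral_mono (integrable_const (-D)) (hint 0) (hD 0)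
    linarith [hle 0]
  have h : ∫ x, (G x + D) ∂μ ≤ D := by
    rw [integral_eq_lintegral_of_nonneg_ae (Filter.Eventually.of_forall hnonneg)
      (hGm.add_const D).aestronglyMeasurable]
    exact ENNReal.toReal_le_of_le_ofReal hDnn hfatou
  rw [integral_add hGint (integrable_const D)] at h
  simpa using h

theorem stmt16 {N : ℕ} (hN : 1 ≤ N) (H : Euc N × Euc N → ℝ)
    (hA1 : Continuous H)
    (hA2conv : ∀ x : Euc N, ConvexOn ℝ Set.univ fun p => H (x, p))
    (hA2coer : ∀ R : ℝ, 0 < R → ∀ C : ℝ, ∃ r : ℝ, ∀ x p : Euc N,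
      ‖x‖ ≤ R → r ≤ ‖p‖ → C ≤ H (x, p))
    (hA3 : ∃ ε > (0 : ℝ), ∃ m : ℝ,
      (∃ R : ℝ, ∀ x : Euc N, R ≤ ‖x‖ → ∀ p : Euc N, ‖p‖ ≤ ε → H (x, p) ≤ m) ∧
      (∃ x₀ : Euc N, ∀ p : Euc N, m < H (x₀, p)))
    (hcrit : sInf {a : ℝ | ∃ u : Euc N → ℝ, IsSubsol H a u} = 0)
    (hsl : ∀ x : Euc N, ∀ C : ℝ, ∃ r : ℝ, ∀ p : Euc N, r ≤ ‖p‖ → C * ‖p‖ ≤ H (x, p))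
    (um : ℝ → Euc N → ℝ)
    (hum : ∀ lam : ℝ, 0 < lam → ∀ x : Euc N,
      um lam x = sSup {r : ℝ | ∃ v : Euc N → ℝ, IsDiscSubsol H lam v ∧ v x = r})
 :
    ∀ lam : ℝ, 0 < lam → ∀ μ : Measure (Euc N × Euc N), MatherMeasure H μ →
      Integrable (fun w : Euc N × Euc N => um lam w.1) μ ∧
      (∫ w : Euc N × Euc N, um lam w.1 ∂μ) ≤ 0 := by
  intro lam hlam μ hμ
  have := hμ.1
  obtain ⟨ε, hε, m, ⟨R, hR⟩, -⟩ := hA3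
  obtain ⟨A, hA⟩ : ∃ A : ℝ, ∀ x : Euc N, H (x, 0) ≤ A := by
    obtain ⟨b, hb⟩ := (isCompact_closedBall (0 : Euc N) R).bddAbove_image
      (f := fun x : Euc N => H (x, 0)) (by fun_prop)
    refine ⟨max b m, fun x => ?_⟩
    rcases le_total R ‖x‖ with h | h
    · exact (hR x h 0 (by simpa using hε.le)).trans (le_max_right _ _)
    · exact (hb ⟨x, by simpa using h, rfl⟩).trans (le_max_left _ _)
  set D : ℝ := max A 0 / lam
  have hD0 : 0 ≤ D := by positivity
  have hconst : IsDiscSubsol H lam (Function.const _ (-D)) := isDiscSubsol_const fun x => by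
    have h1 : lam * D = max A 0 := mul_div_cancel₀ _ hlam.ne'
    have h2 := (hA x).trans (le_max_left A 0)
    linarith
  have hU : IsLUB {v | IsDiscSubsol H lam v} (um lam) := by
    refine isLUB_pi.2 fun x => ?_
    rw [hum lam hlam x]
    exact isLUB_csSup ⟨_, _, hconst, rfl⟩ (bddAbove_isDiscSubsol hA1 hA2coer hlam x)
  obtain ⟨w, hw, hDw, hlim⟩ := exists_seq_isDiscSubsol_tendsto hU hconst
  have hm : ∀ n : ℕ, Measurable fun z : Euc N × Euc N => min (w n z.1) (n : ℝ) := fun n =>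
    (((hw n).1.continuous.comp continuous_fst).min continuous_const).measurable
  have hlow : ∀ (n : ℕ) (z : Euc N × Euc N), -D ≤ min (w n z.1) (n : ℝ) := fun n z =>
    le_min (hDw n z.1) ((neg_nonpos.2 hD0).trans n.cast_nonneg)
  have hint : ∀ n : ℕ, Integrable (fun z : Euc N × Euc N => min (w n z.1) (n : ℝ)) μ := fun n =>
    Integrable.of_mem_Icc (-D) n (hm n).aemeasurable
      (Filter.Eventually.of_forall fun z => ⟨hlow n z, min_le_right _ _⟩)
  refine integrable_and_integral_nonpos_of_tendsto hm hint hlow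
    (fun n => hμ.integral_min_le hA1 hA2conv hsl hA hlam (hw n) n (hint n)) fun z => ?_
  refine (hlim z.1).congr' ?_
  filter_upwards [(hlim z.1).eventually_lt_const (lt_add_one _),
    tendsto_natCast_atTop_atTop.eventually_ge_atTop (um lam z.1 + 1)] with n h1 h2
  exact (min_eq_left (h1.le.trans h2)).symm

end
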